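/- Let S ⊆ ℝ² be a compact convex set with nonempty interior, and let c₁, …, c_a be a closed segments (cuts) such that: each cᵢ has both endpoints on the frontier of S and all other points in the interior of S; the 2a endpoints are pairwise distinct; any two distinct segments intersect in at most one point, which lies in the relative interior of both; and no point belongs to three distinct segments. If k is the number of unordered pairs {i, j} with cᵢ ∩ cⱼ ≠ ∅, then the number of connected components of (interior S) \ (c₁ ∪ ⋯ ∪ c_a) equals k + a + 1. -/

import Mathlib

open Set Filter Topology

section Arrangement

variable {E ι : Type*} [NormedAddCommGroup E] [NormedSpace ℝ E]

/-- The indices in `s` of the affine functionals `l i - b i` that are positive at `x`. -/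
noncomputable def positiveSide (l : ι → E →L[ℝ] ℝ) (b : ι → ℝ) (s : Finset ι) (x : E) : Finset ι :=
  {i ∈ s | b i < l i x}

/-- The cells cut out of `U` by the hyperplanes `l i x = b i` with `i ∈ s`, each encoded by the
indices of the functionals that are positive on it. -/
def arrangementCells (l : ι → E →L[ℝ] ℝ) (b : ι → ℝ) (U : Set E) (s : Finset ι) :
    Set (Finset ι) :=
  positiveSide l b s '' {x ∈ U | ∀ i ∈ s, l i x ≠ b i}

variable {l : ι → E →L[ℝ] ℝ} {b : ι → ℝ} {U : Set E} {s : Finset ι} {g : ι}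

lemma positiveSide_subset (x : E) : positiveSide l b s x ⊆ s := Finset.filter_subset _ _

lemma positiveSide_eq_iff {x y : E} :
    positiveSide l b s x = positiveSide l b s y ↔ ∀ i ∈ s, b i < l i x ↔ b i < l i y := by
  simp only [positiveSide, Finset.filter_inj']

lemma finite_of_subset_powerset {C : Set (Finset ι)} (h : ∀ P ∈ C, P ⊆ s) : C.Finite :=
  s.powerset.finite_toSet.subset fun P hP => by simpa using h P hP

lemma eventually_same_side {x : E} (hx : ∀ i ∈ s, l i x ≠ b i) (v : E) :
    ∀ᶠ t in 𝓝 (0 : ℝ), (∀ i ∈ s, l i (x + t • v) ≠ b i) ∧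
      positiveSide l b s (x + t • v) = positiveSide l b s x := by
  simp only [positiveSide_eq_iff, ← forall₂_and]
  rw [Filter.eventually_all_finset]
  intro i hi
  have hc : Tendsto (fun t : ℝ => l i (x + t • v)) (𝓝 0) (𝓝 (l i x)) := by
    have : Continuous fun t : ℝ => l i (x + t • v) := by fun_prop
    simpa using this.tendsto 0
  rcases (hx i hi).lt_or_gt with h | h
  · filter_upwards [hc.eventually_lt_const h] with t ht
    exact ⟨ht.ne, by constructor <;> intro <;> linarith⟩
  · filter_upwards [hc.eventually_const_lt h] with t ht
    exact ⟨ht.ne', by constructor <;> intro <;> linarith⟩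

lemma exists_both_sides {x v : E} (hx : ∀ i ∈ s, l i x ≠ b i) (hg : l g x = b g)
    (hv : 0 < l g v) (hU : ∀ᶠ t in 𝓝 (0 : ℝ), x + t • v ∈ U) :
    (∃ y ∈ U, (∀ i ∈ s, l i y ≠ b i) ∧ positiveSide l b s y = positiveSide l b s x ∧
      b g < l g y) ∧
    ∃ y ∈ U, (∀ i ∈ s, l i y ≠ b i) ∧ positiveSide l b s y = positiveSide l b s x ∧
      l g y < b g := by
  have h := hU.and (eventually_same_side hx v)
  constructor
  · obtain ⟨t, ⟨h1, h2, h3⟩, ht⟩ :=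
      ((h.filter_mono nhdsWithin_le_nhds).and (self_mem_nhdsWithin (s := Ioi (0 : ℝ)))).exists
    refine ⟨_, h1, h2, h3, ?_⟩
    simpa [hg] using mul_pos ht hv
  · obtain ⟨t, ⟨h1, h2, h3⟩, ht⟩ :=
      ((h.filter_mono nhdsWithin_le_nhds).and (self_mem_nhdsWithin (s := Iio (0 : ℝ)))).exists
    refine ⟨_, h1, h2, h3, ?_⟩
    simpa [hg] using mul_neg_of_neg_of_pos ht hv

lemma convex_positiveSide (hU : Convex ℝ U) (P : Finset ι) :
    Convex ℝ {x ∈ U | (∀ i ∈ s, l i x ≠ b i) ∧ positiveSide l b s x = P} := by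
  classical
  by_cases hP : P ⊆ s
  · have : {x ∈ U | (∀ i ∈ s, l i x ≠ b i) ∧ positiveSide l b s x = P} =
        U ∩ ⋂ i ∈ s, {x | if i ∈ P then b i < l i x else l i x < b i} := by
      ext x
      simp only [mem_inter_iff, mem_iInter, mem_ofPred_eq, and_congr_right_iff]
      intro _
      constructor
      · rintro ⟨h1, rfl⟩ i hi
        split_ifs with h
        · exact (Finset.mem_filter.1 h).2
        · exact lt_of_le_of_ne (not_lt.1 fun h' => h (Finset.mem_filter.2 ⟨hi, h'⟩)) (h1 i hi)
      · intro h
        constructor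
        · intro i hi
          have := h i hi
          split_ifs at this
          exacts [this.ne', this.ne]
        · ext i
          simp only [positiveSide, Finset.mem_filter]
          constructor
          · rintro ⟨hi, h2⟩
            have := h i hi
            split_ifs at this with h3
            exacts [h3, absurd h2 this.not_gt]
          · intro hi
            have := h i (hP hi)
            rw [if_pos hi] at this
            exact ⟨hP hi, this⟩
    rw [this]
    refine hU.inter (convex_iInter₂ fun i _ => ?_)
    split_ifs
    · exact convex_halfSpace_gt (l i).isLinear _
    · exact convex_halfSpace_lt (l i).isLinear _
  · convert convex_empty
    ext x
    simp only [mem_ofPred_eq, mem_empty_iff_false, iff_false, not_and]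
    rintro - - rfl
    exact hP (positiveSide_subset x)

/-- Deletion–restriction for the number of cells of a hyperplane arrangement in a convex set. -/
lemma ncard_arrangementCells_insert [DecidableEq ι] (hU : Convex ℝ U) (hgs : g ∉ s)
    (hg : ∀ x ∈ U, l g x = b g → ∃ v, 0 < l g v ∧ ∀ᶠ t in 𝓝 (0 : ℝ), x + t • v ∈ U) :
    (arrangementCells l b U (insert g s)).ncard =
      (arrangementCells l b U s).ncard +
        (arrangementCells l b (U ∩ {x | l g x = b g}) s).ncard := by
  set N := arrangementCells l b (U ∩ {x | l g x < b g}) s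
  set Q := arrangementCells l b (U ∩ {x | b g < l g x}) s
  have sub : ∀ V, ∀ P ∈ arrangementCells l b V s, P ⊆ s := by
    rintro V _ ⟨x, -, rfl⟩
    exact positiveSide_subset x
  have fin : ∀ V, (arrangementCells l b V s).Finite := fun V =>
    finite_of_subset_powerset (sub V)
  have h_insert : arrangementCells l b U (insert g s) = N ∪ insert g '' Q := by
    ext P
    constructor
    · rintro ⟨x, ⟨hxU, hx⟩, rfl⟩
      rw [Finset.forall_mem_insert] at hx
      rcases hx.1.lt_or_gt with h | h
      · refine Or.inl ⟨x, ⟨⟨hxU, h⟩, hx.2⟩, ?_⟩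
        simp [positiveSide, Finset.filter_insert, h.not_gt]
      · refine Or.inr ⟨_, ⟨x, ⟨⟨hxU, h⟩, hx.2⟩, rfl⟩, ?_⟩
        simp [positiveSide, Finset.filter_insert, h]
    · rintro (⟨x, ⟨⟨hxU, h⟩, hx⟩, rfl⟩ | ⟨_, ⟨x, ⟨⟨hxU, h⟩, hx⟩, rfl⟩, rfl⟩)
      · have h' : l g x < b g := h
        refine ⟨x, ⟨hxU, Finset.forall_mem_insert _ _ _ |>.2 ⟨h'.ne, hx⟩⟩, ?_⟩
        simp [positiveSide, Finset.filter_insert, h'.not_gt]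
      · have h' : b g < l g x := h
        refine ⟨x, ⟨hxU, Finset.forall_mem_insert _ _ _ |>.2 ⟨h'.ne', hx⟩⟩, ?_⟩
        simp [positiveSide, Finset.filter_insert, h']
  have h_disj : Disjoint N (insert g '' Q) := by
    rw [Set.disjoint_left]
    rintro _ hP ⟨R, -, rfl⟩
    exact hgs (sub _ _ hP (Finset.mem_insert_self g R))
  have h_inj : InjOn (insert g) Q := by
    intro P hP R hR h
    have := congrArg (Finset.erase · g) h
    simpa [Finset.erase_insert (fun h => hgs (sub _ _ hP h)),
      Finset.erase_insert (fun h => hgs (sub _ _ hR h))] using this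
  have h_union : N ∪ Q = arrangementCells l b U s := by
    ext P
    constructor
    · rintro (⟨x, ⟨⟨hxU, -⟩, hx⟩, rfl⟩ | ⟨x, ⟨⟨hxU, -⟩, hx⟩, rfl⟩) <;>
        exact ⟨x, ⟨hxU, hx⟩, rfl⟩
    · rintro ⟨x, ⟨hxU, hx⟩, rfl⟩
      rcases lt_trichotomy (l g x) (b g) with h | h | h
      · exact Or.inl ⟨x, ⟨⟨hxU, h⟩, hx⟩, rfl⟩
      · obtain ⟨v, hv, hvU⟩ := hg x hxU h
        obtain ⟨⟨y, hyU, hy, hyx, hyg⟩, -⟩ := exists_both_sides hx h hv hvU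
        exact Or.inr ⟨y, ⟨⟨hyU, hyg⟩, hy⟩, hyx⟩
      · exact Or.inr ⟨x, ⟨⟨hxU, h⟩, hx⟩, rfl⟩
  have h_inter : N ∩ Q = arrangementCells l b (U ∩ {x | l g x = b g}) s := by
    ext P
    constructor
    · rintro ⟨⟨x, ⟨⟨hxU, hxg⟩, hx⟩, hxP⟩, ⟨y, ⟨⟨hyU, hyg⟩, hy⟩, hyP⟩⟩
      have hconv := convex_positiveSide (l := l) (b := b) (s := s) hU P
      obtain ⟨z, hz, hzg⟩ := hconv.isPreconnected.intermediate_value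
        ⟨hxU, hx, hxP⟩ ⟨hyU, hy, hyP⟩ (l g).continuous.continuousOn ⟨le_of_lt hxg, le_of_lt hyg⟩
      exact ⟨z, ⟨⟨hz.1, hzg⟩, hz.2.1⟩, hz.2.2⟩
    · rintro ⟨x, ⟨⟨hxU, hxg⟩, hx⟩, rfl⟩
      obtain ⟨v, hv, hvU⟩ := hg x hxU hxg
      obtain ⟨⟨y, hyU, hy, hyx, hyg⟩, ⟨z, hzU, hz, hzx, hzg⟩⟩ := exists_both_sides hx hxg hv hvU
      exact ⟨⟨z, ⟨⟨hzU, hzg⟩, hz⟩, hzx⟩, ⟨y, ⟨⟨hyU, hyg⟩, hy⟩, hyx⟩⟩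
  rw [h_insert, ncard_union_eq h_disj (fin _) ((fin _).image _), h_inj.ncard_image,
    ← h_union, ← h_inter, ncard_union_add_ncard_inter _ _ (fin _) (fin _)]

lemma arrangementCells_empty_index (hU : U.Nonempty) :
    (arrangementCells l b U ∅).ncard = 1 := by
  rw [ncard_eq_one]
  refine ⟨∅, ?_⟩
  have h : positiveSide l b ∅ = fun _ => ∅ := funext fun _ => Finset.filter_empty _
  simp [arrangementCells, h, hU.image_const]

lemma ncard_arrangementCells_of_subsingleton (hU : U.Subsingleton)
    (h : ∀ x ∈ U, ∀ i ∈ s, l i x ≠ b i) [Decidable U.Nonempty] :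
    (arrangementCells l b U s).ncard = if U.Nonempty then 1 else 0 := by
  have hs : {x ∈ U | ∀ i ∈ s, l i x ≠ b i} = U := by
    ext x
    exact ⟨And.left, fun hx => ⟨hx, h x hx⟩⟩
  rw [arrangementCells, hs]
  split_ifs with hne
  · obtain ⟨x, hx⟩ := hne
    rw [hU.eq_singleton_of_mem hx, image_singleton, ncard_singleton]
  · rw [not_nonempty_iff_eq_empty.1 hne, image_empty, ncard_empty]

/-- The number of cells on a line crossed by hyperplanes at distinct points. -/
lemma ncard_arrangementCells_line (hU : Convex ℝ U) (hne : U.Nonempty)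
    (hg : ∀ j ∈ s, ∀ x ∈ U, l j x = b j →
      ∃ v, 0 < l j v ∧ ∀ᶠ t in 𝓝 (0 : ℝ), x + t • v ∈ U)
    (hsub : ∀ j ∈ s, (U ∩ {x | l j x = b j}).Subsingleton)
    (hdist : ∀ i ∈ s, ∀ j ∈ s, i ≠ j → ∀ x ∈ U, l i x = b i → l j x ≠ b j) :
    (arrangementCells l b U s).ncard =
      {j | j ∈ s ∧ (U ∩ {x | l j x = b j}).Nonempty}.ncard + 1 := by
  classical
  induction s using Finset.induction_on with
  | empty => simp [arrangementCells_empty_index hne]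
  | insert j s hjs ih =>
    rw [ncard_arrangementCells_insert hU hjs (hg j (Finset.mem_insert_self j s)),
      ih (fun i hi => hg i (Finset.mem_insert_of_mem hi))
        (fun i hi => hsub i (Finset.mem_insert_of_mem hi))
        (fun i hi k hk => hdist i (Finset.mem_insert_of_mem hi) k (Finset.mem_insert_of_mem hk)),
      ncard_arrangementCells_of_subsingleton (hsub j (Finset.mem_insert_self j s))]
    · split_ifs with h
      · have : {i | i ∈ insert j s ∧ (U ∩ {x | l i x = b i}).Nonempty} =
            insert j {i | i ∈ s ∧ (U ∩ {x | l i x = b i}).Nonempty} := by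
          ext i
          simp only [Finset.mem_insert, mem_ofPred_eq, Set.mem_insert_iff]
          grind
        rw [this, ncard_insert_of_notMem (fun h => hjs h.1)
          (s.finite_toSet.subset fun i hi => hi.1)]
      · have : {i | i ∈ insert j s ∧ (U ∩ {x | l i x = b i}).Nonempty} =
            {i | i ∈ s ∧ (U ∩ {x | l i x = b i}).Nonempty} := by
          ext i
          simp only [Finset.mem_insert, mem_ofPred_eq]
          grind
        rw [this]
    · rintro x ⟨hxU, hxj⟩ i hi
      exact hdist j (Finset.mem_insert_self j s) i (Finset.mem_insert_of_mem hi)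
        (fun h => hjs (h ▸ hi)) x hxU hxj

end Arrangement

/-- The number of cells of a generic line arrangement in an open convex set. -/
lemma ncard_arrangementCells_generic {E ι : Type*} [NormedAddCommGroup E] [NormedSpace ℝ E]
    [LinearOrder ι] {l : ι → E →L[ℝ] ℝ} {b : ι → ℝ} {U : Set E} {v : ι → E}
    (hU : Convex ℝ U) (hopen : IsOpen U) (hv : ∀ i, v i ≠ 0)
    (hlv : ∀ i, l i (v i) = 0) (hl : ∀ i, ∃ w, l i w ≠ 0)
    (hne : ∀ i, (U ∩ {x | l i x = b i}).Nonempty) (hUne : U.Nonempty)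
    (hpair : ∀ i j, i ≠ j → (U ∩ {x | l i x = b i} ∩ {x | l j x = b j}).Subsingleton)
    (htriple : ∀ i j k, i ≠ j → j ≠ k → i ≠ k → ∀ x ∈ U, l i x = b i → l j x = b j → l k x ≠ b k)
    (s : Finset ι) :
    (arrangementCells l b U s).ncard =
      {q : ι × ι | q.1 ∈ s ∧ q.2 ∈ s ∧ q.1 < q.2 ∧
        (U ∩ {x | l q.1 x = b q.1} ∩ {x | l q.2 x = b q.2}).Nonempty}.ncard + s.card + 1 := by
  have hev : ∀ x ∈ U, ∀ w, ∀ᶠ t in 𝓝 (0 : ℝ), x + t • w ∈ U := by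
    intro x hx w
    have hc : Continuous fun t : ℝ => x + t • w := by fun_prop
    exact hc.continuousAt.eventually_mem (hopen.mem_nhds (by simpa using hx))
  induction s using Finset.induction_on_max with
  | empty => simp [arrangementCells_empty_index hUne]
  | insert g s hmax ih =>
    have hgs : g ∉ s := fun h => lt_irrefl _ (hmax g h)
    rw [ncard_arrangementCells_insert hU hgs, ih, ncard_arrangementCells_line _ (hne g),
      Finset.card_insert_of_notMem hgs]
    · have hset : {q : ι × ι | q.1 ∈ insert g s ∧ q.2 ∈ insert g s ∧ q.1 < q.2 ∧
          (U ∩ {x | l q.1 x = b q.1} ∩ {x | l q.2 x = b q.2}).Nonempty} =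
          {q : ι × ι | q.1 ∈ s ∧ q.2 ∈ s ∧ q.1 < q.2 ∧
            (U ∩ {x | l q.1 x = b q.1} ∩ {x | l q.2 x = b q.2}).Nonempty} ∪
          (fun j => (j, g)) ''
            {j | j ∈ s ∧ (U ∩ {x | l g x = b g} ∩ {x | l j x = b j}).Nonempty} := by
        ext ⟨i, j⟩
        simp only [Finset.mem_insert, mem_ofPred_eq, mem_union, mem_image, Prod.mk.injEq]
        constructor
        · rintro ⟨rfl | hi, rfl | hj, hij, hn⟩
          · exact absurd hij (lt_irrefl _)
          · exact absurd hij (hmax j hj).not_gt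
          · exact Or.inr ⟨i, ⟨hi, by rwa [inter_right_comm]⟩, rfl, rfl⟩
          · exact Or.inl ⟨hi, hj, hij, hn⟩
        · rintro (⟨hi, hj, hij, hn⟩ | ⟨i, ⟨hi, hn⟩, rfl, rfl⟩)
          · exact ⟨Or.inr hi, Or.inr hj, hij, hn⟩
          · exact ⟨Or.inr hi, Or.inl rfl, hmax i hi, by rwa [inter_right_comm]⟩
      have hfin1 : {q : ι × ι | q.1 ∈ s ∧ q.2 ∈ s ∧ q.1 < q.2 ∧
            (U ∩ {x | l q.1 x = b q.1} ∩ {x | l q.2 x = b q.2}).Nonempty}.Finite :=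
        (s ×ˢ s).finite_toSet.subset fun q hq => by
          simpa using ⟨hq.1, hq.2.1⟩
      have hfin2 : {j | j ∈ s ∧ (U ∩ {x | l g x = b g} ∩ {x | l j x = b j}).Nonempty}.Finite :=
        s.finite_toSet.subset fun j hj => hj.1
      rw [hset, ncard_union_eq _ hfin1 (hfin2.image _), ncard_image_of_injective]
      · ring
      · intro i j h
        simpa using h
      · rw [Set.disjoint_left]
        rintro _ ⟨-, h, -⟩ ⟨j, -, rfl⟩
        exact hgs h
    · rintro j hj x ⟨hxU, hxg⟩ hxj
      have hgj : g ≠ j := fun h => hgs (h ▸ hj)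
      have hmove : ∀ c : ℝ, ∀ᶠ t in 𝓝 (0 : ℝ), x + t • (c • v g) ∈ U ∩ {x | l g x = b g} := by
        intro c
        filter_upwards [hev x hxU (c • v g)] with t ht
        exact ⟨ht, by simpa [hlv] using hxg⟩
      have hne0 : l j (v g) ≠ 0 := by
        intro h0
        obtain ⟨t, ht, ht0⟩ := (((hmove 1).filter_mono nhdsWithin_le_nhds).and
          (self_mem_nhdsWithin (s := Ioi (0 : ℝ)))).exists
        have := hpair g j hgj (x := x) ⟨⟨hxU, hxg⟩, hxj⟩ (y := x + t • ((1 : ℝ) • v g))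
          ⟨ht, by simpa [h0] using hxj⟩
        simp [hv g] at this
        exact (ne_of_gt ht0) this
      exact ⟨l j (v g) • v g, by simpa using mul_self_pos.2 hne0, hmove _⟩
    · exact fun j hj => hpair g j fun h => hgs (h ▸ hj)
    · rintro i hi j hj hij x ⟨hxU, hxg⟩ hxi
      exact htriple g i j (fun h => hgs (h ▸ hi)) hij (fun h => hgs (h ▸ hj)) x hxU hxg hxi
    · exact hU.inter (convex_hyperplane (l g).isLinear _)
    · intro x hx _
      obtain ⟨w, hw⟩ := hl g
      exact ⟨l g w • w, by simpa using mul_self_pos.2 hw, hev x hx _⟩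

/-- A locally constant map with preconnected fibres separates the connected components. -/
lemma card_connectedComponents_eq_ncard_range {X Y : Type*} [TopologicalSpace X]
    [TopologicalSpace Y] [DiscreteTopology Y] {f : X → Y} (hf : Continuous f)
    (hfib : ∀ y, IsPreconnected (f ⁻¹' {y})) :
    Nat.card (ConnectedComponents X) = (range f).ncard := by
  rw [← Nat.card_coe_set_eq]
  refine Nat.card_congr ((Equiv.ofInjective hf.connectedComponentsLift ?_).trans
    (Equiv.setCongr ?_))
  · intro p q
    obtain ⟨x, rfl⟩ := ConnectedComponents.surjective_coe p
    obtain ⟨y, rfl⟩ := ConnectedComponents.surjective_coe q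
    intro h
    simp only [Continuous.connectedComponentsLift_apply_coe] at h
    rw [ConnectedComponents.coe_eq_coe']
    exact (hfib (f y)).subset_connectedComponent rfl h
  · rw [← ConnectedComponents.surjective_coe.range_comp, hf.connectedComponentsLift_comp_coe]

lemma card_connectedComponents_arrangement {E ι : Type*} [NormedAddCommGroup E]
    [NormedSpace ℝ E] [Fintype ι] {l : ι → E →L[ℝ] ℝ} {b : ι → ℝ} {U V : Set E}
    (hU : Convex ℝ U) (hV : V = {x ∈ U | ∀ i, l i x ≠ b i}) :
    Nat.card (ConnectedComponents V) = (arrangementCells l b U Finset.univ).ncard := by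
  subst hV
  let _ : TopologicalSpace (Finset ι) := ⊥
  have : DiscreteTopology (Finset ι) := ⟨rfl⟩
  set f : {x ∈ U | ∀ i, l i x ≠ b i} → Finset ι :=
    fun x => positiveSide l b Finset.univ (x : E) with hf
  have hcont : Continuous f := by
    refine continuous_iff_continuousAt.2 fun x => ?_
    refine ContinuousAt.congr (f := fun _ => f x) continuousAt_const ?_
    have : ∀ i, ∀ᶠ y : {x ∈ U | ∀ i, l i x ≠ b i} in 𝓝 x,
        b i < l i (x : E) ↔ b i < l i (y : E) := by
      intro i
      have hc : ContinuousAt (fun y : {x ∈ U | ∀ i, l i x ≠ b i} => l i (y : E)) x := by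
        fun_prop
      rcases (x.2.2 i).lt_or_gt with h | h
      · filter_upwards [hc.eventually_lt_const h] with y hy
        constructor <;> intro <;> linarith
      · filter_upwards [hc.eventually_const_lt h] with y hy
        constructor <;> intro <;> linarith
    filter_upwards [eventually_all.2 this] with y hy
    exact positiveSide_eq_iff.2 fun i _ => hy i
  rw [card_connectedComponents_eq_ncard_range hcont]
  · congr 1
    ext P
    simp [arrangementCells, hf]
  · intro P
    rw [← Topology.IsInducing.subtypeVal.isPreconnected_image]
    convert (convex_positiveSide (l := l) (b := b) (s := Finset.univ) hU P).isPreconnected using 1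
    ext x
    simp [hf]
    tauto

lemma mem_segment_of_mem_interior_of_eq_add_smul {E : Type*} [NormedAddCommGroup E]
    [NormedSpace ℝ E] {S : Set E} (hS : Convex ℝ S) (hclosed : IsClosed S) {A B x : E}
    (hA : A ∈ frontier S) (hB : B ∈ frontier S) (hx : x ∈ interior S) {t : ℝ}
    (hxt : x = A + t • (B - A)) : x ∈ segment ℝ A B := by
  have hAS := hclosed.frontier_subset hA
  have hBS := hclosed.frontier_subset hB
  rw [segment_eq_image']
  refine ⟨t, ⟨?_, ?_⟩, hxt.symm⟩
  · by_contra! ht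
    refine hA.2 ?_
    have h1 : 0 < 1 - t := by linarith
    convert hS.combo_interior_self_mem_interior hx hBS (a := 1 / (1 - t)) (b := -t / (1 - t))
      (by positivity) (div_nonneg (by linarith) h1.le) (by field_simp; ring) using 1
    rw [hxt]
    match_scalars <;> (field_simp; ring)
  · by_contra! ht
    refine hB.2 ?_
    have h1 : 0 < t := by linarith
    convert hS.combo_interior_self_mem_interior hx hAS (a := 1 / t) (b := (t - 1) / t)
      (by positivity) (div_nonneg (by linarith) h1.le) (by field_simp; ring) using 1
    rw [hxt]
    (match_scalars <;> field_simp); ring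

/-- The functional `x ↦ det (d, x)` on the plane. -/
noncomputable def planeDet (d : EuclideanSpace ℝ (Fin 2)) : EuclideanSpace ℝ (Fin 2) →L[ℝ] ℝ :=
  d 0 • EuclideanSpace.proj 1 - d 1 • EuclideanSpace.proj 0

lemma planeDet_apply (d x : EuclideanSpace ℝ (Fin 2)) :
    planeDet d x = d 0 * x 1 - d 1 * x 0 := by
  simp [planeDet]

lemma planeDet_self (d : EuclideanSpace ℝ (Fin 2)) : planeDet d d = 0 := by
  rw [planeDet_apply]
  ring

lemma exists_smul_of_planeDet_eq_zero {d x : EuclideanSpace ℝ (Fin 2)} (hd : d ≠ 0)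
    (h : planeDet d x = 0) : ∃ t : ℝ, x = t • d := by
  rw [planeDet_apply] at h
  by_cases h0 : d 0 = 0
  · have h1 : d 1 ≠ 0 := by
      intro h1
      apply hd
      ext i
      fin_cases i <;> simp [h0, h1]
    refine ⟨x 1 / d 1, ?_⟩
    have : x 0 = 0 := by simpa [h0, h1] using h
    ext i
    fin_cases i <;> simp [h0, h1, this]
  · refine ⟨x 0 / d 0, ?_⟩
    ext i
    fin_cases i
    · simp [h0]
    · simp
      field_simp
      linarith

lemma exists_planeDet_ne_zero {d : EuclideanSpace ℝ (Fin 2)} (hd : d ≠ 0) :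
    ∃ w, planeDet d w ≠ 0 := by
  by_contra! h
  apply hd
  have h0 := h (EuclideanSpace.single 1 1)
  have h1 := h (EuclideanSpace.single 0 1)
  rw [planeDet_apply] at h0 h1
  ext i
  fin_cases i
  · simpa using h0
  · simpa using h1

/-- Inside `S`, a chord coincides with the line that carries it. -/
lemma interior_inter_segment_eq {S : Set (EuclideanSpace ℝ (Fin 2))} (hS : Convex ℝ S)
    (hclosed : IsClosed S) {A B : EuclideanSpace ℝ (Fin 2)} (hA : A ∈ frontier S)
    (hB : B ∈ frontier S) (hAB : A ≠ B) :
    interior S ∩ segment ℝ A B =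
      interior S ∩ {x | planeDet (B - A) x = planeDet (B - A) A} := by
  ext x
  simp only [mem_inter_iff, mem_ofPred_eq, and_congr_right_iff]
  intro hx
  constructor
  · intro h
    rw [segment_eq_image'] at h
    obtain ⟨t, -, rfl⟩ := h
    rw [map_add, map_smul, planeDet_self, smul_zero, add_zero]
  · intro h
    obtain ⟨t, ht⟩ := exists_smul_of_planeDet_eq_zero (sub_ne_zero.2 hAB.symm)
      (x := x - A) (by rw [map_sub, h, sub_self])
    exact mem_segment_of_mem_interior_of_eq_add_smul hS hclosed hA hB hx
      (sub_eq_iff_eq_add'.1 ht)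

/-- Euler-formula count of pieces of a crossing-cuts puzzle: if a compact convex set `S` in the
plane with nonempty interior is cut by `a` chords in general position (endpoints on the
frontier, interiors of the segments inside `S`, all `2a` endpoints distinct, two cuts meet in
at most one point lying in the relative interior of both, no three cuts concurrent), and `k`
is the number of intersecting pairs of cuts, then the interior of `S` minus the cuts has
exactly `k + a + 1` connected components. -/
theorem crossing_cuts_piece_count (S : Set (EuclideanSpace ℝ (Fin 2)))
    (hScompact : IsCompact S) (hSconv : Convex ℝ S) (hSint : (interior S).Nonempty)
    (a : ℕ) (A B : Fin a → EuclideanSpace ℝ (Fin 2))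
    (hfrontier : ∀ i, A i ∈ frontier S ∧ B i ∈ frontier S)
    (hinside : ∀ i, segment ℝ (A i) (B i) \ {A i, B i} ⊆ interior S)
    (hendpoints : Function.Injective (Sum.elim A B))
    (hpair : ∀ i j, i ≠ j →
      (segment ℝ (A i) (B i) ∩ segment ℝ (A j) (B j)).Subsingleton ∧
        segment ℝ (A i) (B i) ∩ segment ℝ (A j) (B j) ⊆
          openSegment ℝ (A i) (B i) ∩ openSegment ℝ (A j) (B j))
    (htriple : ∀ i j k : Fin a, i ≠ j → j ≠ k → i ≠ k →
      segment ℝ (A i) (B i) ∩ segment ℝ (A j) (B j) ∩ segment ℝ (A k) (B k) = ∅)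
    (k : ℕ)
    (hk : k = {q : Fin a × Fin a | q.1 < q.2 ∧
        (segment ℝ (A q.1) (B q.1) ∩ segment ℝ (A q.2) (B q.2)).Nonempty}.ncard) :
    Nat.card (ConnectedComponents
        ↥(interior S \ ⋃ i, segment ℝ (A i) (B i))) = k + a + 1 := by
  have hAB : ∀ i, A i ≠ B i := fun i h => by
    simpa using hendpoints (a₁ := Sum.inl i) (a₂ := Sum.inr i) h
  have hopen : ∀ i, openSegment ℝ (A i) (B i) ⊆ interior S := by
    intro i x hx
    refine hinside i ⟨openSegment_subset_segment _ _ _ hx, ?_⟩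
    rintro (rfl | rfl)
    · exact hAB i (left_mem_openSegment_iff.1 hx)
    · exact hAB i (right_mem_openSegment_iff.1 hx)
  set l : Fin a → EuclideanSpace ℝ (Fin 2) →L[ℝ] ℝ := fun i => planeDet (B i - A i)
  set b : Fin a → ℝ := fun i => l i (A i)
  have hd : ∀ i, B i - A i ≠ 0 := fun i => sub_ne_zero.2 (hAB i).symm
  have hseg : ∀ i, ∀ x ∈ interior S, x ∈ segment ℝ (A i) (B i) ↔ l i x = b i := by
    intro i x hx
    have := Set.ext_iff.1 (interior_inter_segment_eq hSconv hScompact.isClosed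
      (hfrontier i).1 (hfrontier i).2 (hAB i)) x
    simpa [hx] using this
  rw [card_connectedComponents_arrangement (l := l) (b := b) hSconv.interior,
    ncard_arrangementCells_generic (v := fun i => B i - A i) hSconv.interior isOpen_interior hd
      (fun i => planeDet_self _) (fun i => exists_planeDet_ne_zero (hd i)) _ hSint]
  · rw [hk, Finset.card_univ, Fintype.card_fin]
    congr 3
    ext ⟨i, j⟩
    simp only [Finset.mem_univ, true_and, mem_ofPred_eq, and_congr_right_iff]
    intro hij
    constructor
    · rintro ⟨x, ⟨hx, hxi⟩, hxj⟩
      exact ⟨x, (hseg i x hx).2 hxi, (hseg j x hx).2 hxj⟩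
    · rintro ⟨x, hxi, hxj⟩
      have hx := hopen i ((hpair i j hij.ne).2 ⟨hxi, hxj⟩).1
      exact ⟨x, ⟨hx, (hseg i x hx).1 hxi⟩, (hseg j x hx).1 hxj⟩
  · rintro i j hij x ⟨⟨hx, hxi⟩, hxj⟩ y ⟨⟨hy, hyi⟩, hyj⟩
    exact (hpair i j hij).1 ⟨(hseg i x hx).2 hxi, (hseg j x hx).2 hxj⟩
      ⟨(hseg i y hy).2 hyi, (hseg j y hy).2 hyj⟩
  · intro i j m hij hjm him x hx hxi hxj hxm
    have : x ∈ (∅ : Set (EuclideanSpace ℝ (Fin 2))) := htriple i j m hij hjm him ▸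
      ⟨⟨(hseg i x hx).2 hxi, (hseg j x hx).2 hxj⟩, (hseg m x hx).2 hxm⟩
    exact this
  · intro i
    obtain ⟨x, hx⟩ : (openSegment ℝ (A i) (B i)).Nonempty :=
      ⟨_, midpoint_mem_openSegment (A i) (B i)⟩
    exact ⟨x, hopen i hx, (hseg i x (hopen i hx)).1 (openSegment_subset_segment _ _ _ hx)⟩
  · ext x
    simp only [Set.mem_sdiff, mem_iUnion, not_exists, mem_ofPred_eq, and_congr_right_iff]
    intro hx
    exact forall_congr' fun i => (hseg i x hx).not
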